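/- Let M be a sober MT-algebra such that O(M) is a spatial frame. Then the map η restricted to O(M) is a frame isomorphism from O(M) onto the topology of the atom space at(M); in particular, for all a, b ∈ O(M), a ≤ b if and only if η(a) ⊆ η(b). -/

import Mathlib

/-- An MT-algebra: a complete Boolean algebra with an interior operator. -/
structure MTAlg (M : Type*) [CompleteBooleanAlgebra M] where
  box : M → M
  box_top : box ⊤ = ⊤
  box_inf : ∀ a b : M, box (a ⊓ b) = box a ⊓ box b
  box_le : ∀ a : M, box a ≤ a
  box_idem : ∀ a : M, box a ≤ box (box a)

namespace MTAlg

variable {M : Type*} [CompleteBooleanAlgebra M] (T : MTAlg M)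

/-- The closure (dual) operator. -/
def dia (a : M) : M := (T.box aᶜ)ᶜ

/-- Open elements. -/
def IsOpenElem (a : M) : Prop := T.box a = a

/-- Closed elements. -/
def IsClosedElem (a : M) : Prop := T.dia a = a

/-- Saturated elements: meets of open elements. -/
def IsSaturatedElem (a : M) : Prop :=
  ∃ S : Set M, (∀ s ∈ S, T.IsOpenElem s) ∧ a = sInf S

/-- Weakly locally closed elements: meets of a saturated and a closed element. -/
def IsWLC (a : M) : Prop :=
  ∃ s c : M, T.IsSaturatedElem s ∧ T.IsClosedElem c ∧ a = s ⊓ c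

/-- T0-algebras: every element is a join of weakly locally closed elements. -/
def IsT0 : Prop :=
  ∀ a : M, ∃ S : Set M, (∀ b ∈ S, T.IsWLC b) ∧ a = sSup S

/-- T1-algebras: every element is a join of closed elements. -/
def IsT1 : Prop :=
  ∀ a : M, ∃ S : Set M, (∀ b ∈ S, T.IsClosedElem b) ∧ a = sSup S

/-- Join-irreducible elements of the lattice of closed elements. -/
def JoinIrredClosed (p : M) : Prop :=
  T.IsClosedElem p ∧ p ≠ ⊥ ∧
    ∀ a b : M, T.IsClosedElem a → T.IsClosedElem b → p = a ⊔ b → p = a ∨ p = b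

/-- Sober MT-algebras. -/
def Sober : Prop :=
  T.IsT0 ∧ ∀ p : M, T.JoinIrredClosed p → ∃ x : M, IsAtom x ∧ p = T.dia x

/-- Filters of the underlying lattice. -/
def IsFilter (F : Set M) : Prop :=
  ⊤ ∈ F ∧ (∀ a b : M, a ∈ F → a ≤ b → b ∈ F) ∧ (∀ a b : M, a ∈ F → b ∈ F → a ⊓ b ∈ F)

/-- Open filters. -/
def IsOpenFilter (F : Set M) : Prop :=
  IsFilter F ∧ ∀ a ∈ F, T.box a ∈ F

/-- Scott-open filters. -/
def IsScottOpenFilter (F : Set M) : Prop :=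
  T.IsOpenFilter F ∧
    ∀ S : Set M, (∀ s ∈ S, T.IsOpenElem s) → S.Nonempty → DirectedOn (· ≤ ·) S →
      sSup S ∈ F → ∃ s ∈ S, s ∈ F

/-- Compact elements. -/
def IsCompactElem (a : M) : Prop :=
  ∀ S : Set M, (∀ s ∈ S, T.IsOpenElem s) → a ≤ sSup S →
    ∃ t ⊆ S, t.Finite ∧ a ≤ sSup t

/-- The relation `a ◁ b`: there is a compact element between `a` and `b`. -/
def Triangle (a b : M) : Prop := ∃ k : M, T.IsCompactElem k ∧ a ≤ k ∧ k ≤ b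

/-- Locally compact MT-algebras. -/
def LocallyCompact : Prop :=
  ∀ u : M, T.IsOpenElem u → u = sSup {v : M | T.IsOpenElem v ∧ T.Triangle v u}

/-- The way-below relation in the frame of open elements. -/
def WayBelowOpen (a b : M) : Prop :=
  ∀ S : Set M, (∀ s ∈ S, T.IsOpenElem s) → b ≤ sSup S →
    ∃ t ⊆ S, t.Finite ∧ a ≤ sSup t

/-- Elements approximated from above by regular closed elements. -/
def GC (a : M) : Prop :=
  a = sInf {b : M | ∃ c : M, a ≤ T.box c ∧ b = T.dia (T.box c)}

/-- Hausdorff MT-algebras. -/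
def IsHausdorff : Prop :=
  ∀ a : M, ∃ S : Set M, (∀ b ∈ S, T.GC b) ∧ a = sSup S

/-- Regular MT-algebras. -/
def IsRegular : Prop :=
  T.IsT1 ∧ ∀ a : M, T.IsOpenElem a →
    a = sSup {b : M | T.IsOpenElem b ∧ T.dia b ≤ a}

end MTAlg

/-- The atom space of a complete Boolean algebra. -/
abbrev AtomSpace (M : Type*) [CompleteBooleanAlgebra M] : Type _ := {x : M // IsAtom x}

/-- The set of atoms below an element. -/
def eta {M : Type*} [CompleteBooleanAlgebra M] (a : M) : Set (AtomSpace M) :=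
  {x : AtomSpace M | x.1 ≤ a}

namespace MTAlg

variable {M : Type*} [CompleteBooleanAlgebra M] (T : MTAlg M)

/-- The topology on the atom space, generated by the images of open elements. -/
def atTop : TopologicalSpace (AtomSpace M) :=
  TopologicalSpace.generateFrom {U : Set (AtomSpace M) | ∃ u : M, T.IsOpenElem u ∧ U = eta u}

end MTAlg

namespace MTAlg

variable {M : Type*} [CompleteBooleanAlgebra M] (T : MTAlg M)

/-- A completely prime filter of the frame of open elements. -/
def CPFilterOpen (p : Set M) : Prop :=
  (∀ a ∈ p, T.IsOpenElem a) ∧ ⊤ ∈ p ∧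
    (∀ a b : M, a ∈ p → T.IsOpenElem b → a ≤ b → b ∈ p) ∧
    (∀ a b : M, a ∈ p → b ∈ p → a ⊓ b ∈ p) ∧
    ∀ S : Set M, (∀ s ∈ S, T.IsOpenElem s) → sSup S ∈ p → ∃ s ∈ S, s ∈ p

/-- Spatiality of the frame of open elements: whenever `a ≰ b` there is a
completely prime filter containing `a` but not `b`. -/
def SpatialOpenFrame : Prop :=
  ∀ a b : M, T.IsOpenElem a → T.IsOpenElem b → ¬ a ≤ b →
    ∃ p : Set M, T.CPFilterOpen p ∧ a ∈ p ∧ b ∉ p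

end MTAlg

namespace MTAlg

variable {M : Type*} [CompleteBooleanAlgebra M] (T : MTAlg M)

theorem box_mono {a b : M} (h : a ≤ b) : T.box a ≤ T.box b := by
  have hab := T.box_inf a b
  rw [inf_eq_left.mpr h] at hab
  exact inf_eq_left.mp hab.symm

theorem isOpenElem_box (a : M) : T.IsOpenElem (T.box a) :=
  le_antisymm (T.box_le _) (T.box_idem a)

theorem isOpenElem_sSup {S : Set M} (hS : ∀ s ∈ S, T.IsOpenElem s) :
    T.IsOpenElem (sSup S) :=
  le_antisymm (T.box_le _) <| sSup_le fun s hs =>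
    (hS s hs).symm.le.trans (T.box_mono (le_sSup hs))

variable {T}

theorem IsOpenElem.le_box_iff {a b : M} (ha : T.IsOpenElem a) : a ≤ T.box b ↔ a ≤ b :=
  ⟨fun h => h.trans (T.box_le b), fun h => ha.symm.le.trans (T.box_mono h)⟩

theorem IsOpenElem.isClosedElem_compl {a : M} (ha : T.IsOpenElem a) :
    T.IsClosedElem aᶜ := by
  rw [IsClosedElem, dia, compl_compl, ha]

theorem IsClosedElem.isOpenElem_compl {a : M} (ha : T.IsClosedElem a) :
    T.IsOpenElem aᶜ := by
  rw [IsClosedElem, dia] at ha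
  rw [IsOpenElem, ← compl_compl (T.box aᶜ), ha]

/-- A completely prime filter of opens is determined by the largest open outside it. -/
theorem CPFilterOpen.exists_mem_iff_not_le {p : Set M} (hp : T.CPFilterOpen p) :
    ∃ w : M, T.IsOpenElem w ∧ ∀ u : M, T.IsOpenElem u → (u ∈ p ↔ ¬ u ≤ w) := by
  obtain ⟨-, -, hup, -, hprime⟩ := hp
  have hS : ∀ s ∈ {u : M | T.IsOpenElem u ∧ u ∉ p}, T.IsOpenElem s := fun s hs => hs.1
  refine ⟨sSup {u : M | T.IsOpenElem u ∧ u ∉ p}, T.isOpenElem_sSup hS,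
    fun u hu => ⟨fun hup' hle => ?_, fun hle => ?_⟩⟩
  · obtain ⟨s, hs, hsp⟩ := hprime _ hS (hup _ _ hup' (T.isOpenElem_sSup hS) hle)
    exact hs.2 hsp
  · by_contra hu'
    exact hle (le_sSup ⟨hu, hu'⟩)

/-- In a sober MT-algebra, every completely prime filter of opens is the filter of open
neighbourhoods of an atom. -/
theorem Sober.exists_atom_of_cpFilterOpen (hsob : T.Sober) {p : Set M}
    (hp : T.CPFilterOpen p) :
    ∃ x : M, IsAtom x ∧ ∀ u : M, T.IsOpenElem u → (u ∈ p ↔ x ≤ u) := by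
  obtain ⟨w, hw, hmem⟩ := hp.exists_mem_iff_not_le
  have hwp : w ∉ p := fun h => (hmem w hw).mp h le_rfl
  obtain ⟨-, htop, -, hinf, -⟩ := hp
  have hirr : T.JoinIrredClosed wᶜ := by
    refine ⟨hw.isClosedElem_compl, fun h => hwp ?_, fun a b ha hb hab => ?_⟩
    · rwa [compl_eq_bot.mp h]
    · have hw' : w = aᶜ ⊓ bᶜ := by rw [← compl_sup, ← hab, compl_compl]
      by_cases hap : aᶜ ∈ p
      · have hbp : bᶜ ∉ p := fun hbp => hwp (hw' ▸ hinf _ _ hap hbp)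
        have hbw : bᶜ ≤ w := by
          simpa using mt (hmem _ hb.isOpenElem_compl).mpr hbp
        right
        rw [le_antisymm (hw'.le.trans inf_le_right) hbw, compl_compl]
      · have haw : aᶜ ≤ w := by
          simpa using mt (hmem _ ha.isOpenElem_compl).mpr hap
        left
        rw [le_antisymm (hw'.le.trans inf_le_left) haw, compl_compl]
  obtain ⟨x, hx, hwx⟩ := hsob.2 _ hirr
  have hwbox : w = T.box xᶜ := compl_injective hwx
  refine ⟨x, hx, fun u hu => ?_⟩
  rw [hmem u hu, hwbox, hu.le_box_iff, le_compl_iff_disjoint_left, hx.not_disjoint_iff_le]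

theorem Sober.le_iff_eta_subset (hsob : T.Sober) (hsp : T.SpatialOpenFrame) {a b : M}
    (ha : T.IsOpenElem a) (hb : T.IsOpenElem b) : a ≤ b ↔ eta a ⊆ eta b := by
  refine ⟨fun h x hx => le_trans hx h, fun h => ?_⟩
  by_contra hab
  obtain ⟨p, hp, hap, hbp⟩ := hsp a b ha hb hab
  obtain ⟨x, hx, hxp⟩ := hsob.exists_atom_of_cpFilterOpen hp
  exact hbp ((hxp b hb).mpr (h (a := ⟨x, hx⟩) ((hxp a ha).mp hap)))

end MTAlg

/-- For a sober MT-algebra whose frame of opens is spatial, `η` restricts to a frame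
isomorphism from the frame of open elements onto the topology of the atom space;
in particular it is an order embedding on opens. -/
theorem eta_frame_iso_of_sober_spatial {M : Type*} [CompleteBooleanAlgebra M]
    (T : MTAlg M) (hsob : T.Sober) (hsp : T.SpatialOpenFrame) :
    (∃ e : {a : M // T.IsOpenElem a} ≃o
        {U : Set (AtomSpace M) // ∃ u : M, T.IsOpenElem u ∧ U = eta u},
      ∀ a : {a : M // T.IsOpenElem a}, (e a).1 = eta a.1) ∧
    ∀ a b : M, T.IsOpenElem a → T.IsOpenElem b → (a ≤ b ↔ eta a ⊆ eta b) := by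
  have hle : ∀ a b : M, T.IsOpenElem a → T.IsOpenElem b → (a ≤ b ↔ eta a ⊆ eta b) :=
    fun a b ha hb => hsob.le_iff_eta_subset hsp ha hb
  let f : {a : M // T.IsOpenElem a} ↪o
      {U : Set (AtomSpace M) // ∃ u : M, T.IsOpenElem u ∧ U = eta u} :=
    OrderEmbedding.ofMapLEIff (fun a => ⟨eta a.1, a.1, a.2, rfl⟩)
      fun a b => (hle a.1 b.1 a.2 b.2).symm
  have hf : Function.Surjective f := by
    rintro ⟨_, u, hu, rfl⟩
    exact ⟨⟨u, hu⟩, rfl⟩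
  exact ⟨⟨RelIso.ofSurjective f hf, fun a => rfl⟩, hle⟩
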